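/- arXiv:2605.02361 — 2 statements merged into one kernel-verified Lean document; each statement's English description precedes it below -/
import Mathlib

section
/- Let φ be a negation-free STL formula whose atoms are set-membership predicates π_i := (x(t) ∈ C_i) for subsets C_1, …, C_m ⊆ ℝⁿ. Let (E_t)_{t≥0} be a family of subsets of ℝⁿ, and let φ̃ be the formula obtained from φ by replacing each atom π_i with the time-varying tightened atom π̃_{i,t} := (x(t) ∈ C_i ⊖ E_t), leaving all logical and temporal operators unchanged. Then for every trajectory x : ℝ_{≥0} → ℝⁿ, every curve e : ℝ_{≥0} → ℝⁿ with e_t ∈ E_t for all t, and every time t ≥ 0: (x, t) ⊨ φ̃ implies (x + e, t) ⊨ φ, where (x+e)(τ) := x(τ) + e(τ). -/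
/-- Pontryagin difference: `A ⊖ B = {x | x + b ∈ A for all b ∈ B}`. -/
def pontryaginDiff {n : ℕ} (A B : Set (Fin n → ℝ)) : Set (Fin n → ℝ) :=
  {x | ∀ b ∈ B, x + b ∈ A}

/-- Negation-free STL formulas over a family of atomic predicates indexed by `I`. -/
inductive STL (I : Type*) where
  | atom : I → STL I
  | and : STL I → STL I → STL I
  | or : STL I → STL I → STL I
  | always : ℝ → ℝ → STL I → STL I
  | eventually : ℝ → ℝ → STL I → STL I
  | untl : ℝ → ℝ → STL I → STL I → STL I

/-- Well-formedness: every temporal interval `[a,b]` satisfies `0 ≤ a ≤ b`. -/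
def STL.WF {I : Type*} : STL I → Prop
  | .atom _ => True
  | .and φ ψ => φ.WF ∧ ψ.WF
  | .or φ ψ => φ.WF ∧ ψ.WF
  | .always a b φ => 0 ≤ a ∧ a ≤ b ∧ φ.WF
  | .eventually a b φ => 0 ≤ a ∧ a ≤ b ∧ φ.WF
  | .untl a b φ ψ => 0 ≤ a ∧ a ≤ b ∧ φ.WF ∧ ψ.WF

/-- Boolean satisfaction of an STL formula at time `t`, given an interpretation `v`
assigning to each atom a time-varying truth value. -/
def STL.Sat {I : Type*} (v : I → ℝ → Prop) : STL I → ℝ → Prop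
  | .atom i, t => v i t
  | .and φ ψ, t => φ.Sat v t ∧ ψ.Sat v t
  | .or φ ψ, t => φ.Sat v t ∨ ψ.Sat v t
  | .always a b φ, t => ∀ τ ∈ Set.Icc (t + a) (t + b), φ.Sat v τ
  | .eventually a b φ, t => ∃ τ ∈ Set.Icc (t + a) (t + b), φ.Sat v τ
  | .untl a b φ ψ, t =>
      ∃ τ ∈ Set.Icc (t + a) (t + b), ψ.Sat v τ ∧ ∀ τ' ∈ Set.Icc t τ, φ.Sat v τ'

/-- Satisfaction of a well-formed formula is monotone in the interpretation of the atoms, and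
depends only on nonnegative times. -/
theorem STL.Sat.mono {I : Type*} {v w : I → ℝ → Prop}
    (hvw : ∀ i s, 0 ≤ s → v i s → w i s) {φ : STL I} (hφ : φ.WF) {t : ℝ} (ht : 0 ≤ t)
    (h : φ.Sat v t) : φ.Sat w t := by
  induction φ generalizing t with
  | atom i => exact hvw i t ht h
  | and φ ψ ihφ ihψ => exact ⟨ihφ hφ.1 ht h.1, ihψ hφ.2 ht h.2⟩
  | or φ ψ ihφ ihψ => exact h.imp (ihφ hφ.1 ht) (ihψ hφ.2 ht)
  | always a b φ ih =>
    obtain ⟨ha, -, hφ⟩ := hφ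
    exact fun τ hτ => ih hφ ((add_nonneg ht ha).trans hτ.1) (h τ hτ)
  | eventually a b φ ih =>
    obtain ⟨ha, -, hφ⟩ := hφ
    obtain ⟨τ, hτ, h⟩ := h
    exact ⟨τ, hτ, ih hφ ((add_nonneg ht ha).trans hτ.1) h⟩
  | untl a b φ ψ ihφ ihψ =>
    obtain ⟨ha, -, hφ, hψ⟩ := hφ
    obtain ⟨τ, hτ, hτψ, hτφ⟩ := h
    exact ⟨τ, hτ, ihψ hψ ((add_nonneg ht ha).trans hτ.1) hτψ,
      fun τ' hτ' => ihφ hφ (ht.trans hτ'.1) (hτφ τ' hτ')⟩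

/-- STL formula erosion (deterministic version): if the nominal trajectory `x` satisfies
the formula with every atom `x(t) ∈ C i` replaced by the eroded atom
`x(t) ∈ C i ⊖ E t`, then for any perturbation curve `e` with `e t ∈ E t` for all `t ≥ 0`,
the perturbed trajectory `x + e` satisfies the original formula. -/
theorem STL.erosion {m n : ℕ}
    (φ : STL (Fin m)) (hφ : φ.WF)
    (C : Fin m → Set (Fin n → ℝ))
    (E : ℝ → Set (Fin n → ℝ)) :
    ∀ (x e : ℝ → (Fin n → ℝ)),
      (∀ t : ℝ, 0 ≤ t → e t ∈ E t) →
      ∀ t : ℝ, 0 ≤ t →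
        φ.Sat (fun i s => x s ∈ pontryaginDiff (C i) (E s)) t →
        φ.Sat (fun i s => x s + e s ∈ C i) t := by
  intro x e he t ht h
  exact h.mono (fun i s hs hx => hx (e s) (he s hs)) hφ ht
end

section
/- Let A : [0, T] → ℝ^{n×n} and B : [0, T] → ℝ^{n×p} be continuous, let W : [0, T] → ℝ^{n×n} be a differentiable family of symmetric positive definite matrices, let Y : [0, T] → ℝ^{p×n} be continuous, and let c ∈ ℝ. Suppose the dual contraction linear matrix inequality −Ẇ_t + A_t W_t + W_t A_tᵀ + B_t Y_t + Y_tᵀ B_tᵀ ⪯ 2 c W_t holds for all t ∈ [0, T]. Define M_t := W_t^{−1} and K_t := Y_t W_t^{−1}. Then for every differentiable curve δx : [0, T] → ℝⁿ satisfying the closed-loop differential dynamics δx′_t = (A_t + B_t K_t) δx_t, one has d/dt [ δx_tᵀ M_t δx_t ] ≤ 2 c · δx_tᵀ M_t δx_t for all t ∈ [0, T]; that is, the closed-loop differential dynamics are contracting with rate c and metric M_t. -/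
open Matrix

section

open scoped Matrix.Norms.Operator

/-- Entrywise derivative of the inverse of a differentiable curve of invertible matrices. -/
theorem Matrix.hasDerivWithinAt_inv_apply {m : Type*} [Fintype m] [DecidableEq m]
    {W : ℝ → Matrix m m ℝ} {W' : Matrix m m ℝ} {s : Set ℝ} {t : ℝ}
    (hW : ∀ i j, HasDerivWithinAt (fun r => W r i j) (W' i j) s t) (hu : IsUnit (W t)) (i j : m) :
    HasDerivWithinAt (fun r => (W r)⁻¹ i j) ((-((W t)⁻¹ * W' * (W t)⁻¹)) i j) s t := by
  have h1 : HasDerivWithinAt W W' s t :=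
    hasDerivWithinAt_pi.2 fun i => hasDerivWithinAt_pi.2 fun j => hW i j
  obtain ⟨u, hu⟩ := hu
  have h2 := hasFDerivAt_ringInverse (𝕜 := ℝ) u
  rw [hu] at h2
  have h3 : HasDerivWithinAt (fun r => (W r)⁻¹) (-((W t)⁻¹ * W' * (W t)⁻¹)) s t := by
    have h4 := h2.comp_hasDerivWithinAt t h1
    have h5 : (↑u⁻¹ : Matrix m m ℝ) = (W t)⁻¹ := by
      rw [← hu, Matrix.coe_units_inv]
    simp only [Function.comp_def, h5, _root_.neg_apply,
      ContinuousLinearMap.mulLeftRight_apply, ← Matrix.nonsing_inv_eq_ringInverse] at h4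
    exact h4
  exact hasDerivWithinAt_pi.1 (hasDerivWithinAt_pi.1 h3 i) j

end

/-- The product rule for a time-varying quadratic form. -/
theorem Matrix.hasDerivWithinAt_dotProduct_mulVec {m : Type*} [Fintype m]
    {M : ℝ → Matrix m m ℝ} {M' : Matrix m m ℝ} {x : ℝ → m → ℝ} {x' : m → ℝ} {s : Set ℝ} {t : ℝ}
    (hM : ∀ i j, HasDerivWithinAt (fun r => M r i j) (M' i j) s t)
    (hx : HasDerivWithinAt x x' s t) :
    HasDerivWithinAt (fun r => x r ⬝ᵥ (M r *ᵥ x r))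
      (x' ⬝ᵥ (M t *ᵥ x t) + x t ⬝ᵥ (M' *ᵥ x t) + x t ⬝ᵥ (M t *ᵥ x')) s t := by
  have hxi := hasDerivWithinAt_pi.1 hx
  have h := HasDerivWithinAt.fun_sum (u := Finset.univ) fun i _ =>
    (hxi i).fun_mul (HasDerivWithinAt.fun_sum (u := Finset.univ) fun j _ =>
      (hM i j).fun_mul (hxi j))
  refine h.congr_deriv ?_
  simp only [dotProduct, mulVec, Finset.sum_add_distrib, mul_add, add_assoc]

/-- TVCCM synthesis: feasibility of the dual contraction LMI
`−Ẇ + AW + WAᵀ + BY + YᵀBᵀ ⪯ 2cW` certifies contraction of the closed-loop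
differential dynamics `δx' = (A + BK)δx` with rate `c` in the metric `M = W⁻¹`,
where `K = YW⁻¹`. -/
theorem tvccm_contraction {n p : ℕ} (T : ℝ) (hT : 0 < T)
    (A : ℝ → Matrix (Fin n) (Fin n) ℝ) (B : ℝ → Matrix (Fin n) (Fin p) ℝ)
    (Y : ℝ → Matrix (Fin p) (Fin n) ℝ) (c : ℝ)
    (hA : ∀ i j, ContinuousOn (fun t => A t i j) (Set.Icc 0 T))
    (hB : ∀ i j, ContinuousOn (fun t => B t i j) (Set.Icc 0 T))
    (hY : ∀ i j, ContinuousOn (fun t => Y t i j) (Set.Icc 0 T))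
    (W W' : ℝ → Matrix (Fin n) (Fin n) ℝ)
    (hW : ∀ t ∈ Set.Icc (0 : ℝ) T, ∀ i j,
      HasDerivWithinAt (fun s => W s i j) (W' t i j) (Set.Icc 0 T) t)
    (hWsymm : ∀ t ∈ Set.Icc (0 : ℝ) T, (W t).IsSymm)
    (hWpos : ∀ t ∈ Set.Icc (0 : ℝ) T, (W t).PosDef)
    (hLMI : ∀ t ∈ Set.Icc (0 : ℝ) T,
      ((2 * c) • W t -
        (-(W' t) + A t * W t + W t * (A t)ᵀ + B t * Y t + (Y t)ᵀ * (B t)ᵀ)).PosSemidef) :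
    ∀ δx : ℝ → (Fin n → ℝ),
      (∀ t ∈ Set.Icc (0 : ℝ) T,
        HasDerivWithinAt δx ((A t + B t * (Y t * (W t)⁻¹)) *ᵥ δx t) (Set.Icc 0 T) t) →
      ∀ t ∈ Set.Icc (0 : ℝ) T,
        derivWithin (fun s => δx s ⬝ᵥ ((W s)⁻¹ *ᵥ δx s)) (Set.Icc 0 T) t ≤
          2 * c * (δx t ⬝ᵥ ((W t)⁻¹ *ᵥ δx t)) := by
  intro δx hδ t ht
  set V := (W t)⁻¹ with hV
  have hu : IsUnit (W t) := (hWpos t ht).isUnit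
  have hdet : IsUnit (W t).det := (Matrix.isUnit_iff_isUnit_det _).1 hu
  have hderiv := Matrix.hasDerivWithinAt_dotProduct_mulVec
    (Matrix.hasDerivWithinAt_inv_apply (hW t ht) hu) (hδ t ht)
  rw [hderiv.derivWithin (uniqueDiffOn_Icc hT t ht), ← hV]
  have hVsymm : Vᵀ = V := by rw [hV, Matrix.transpose_nonsing_inv, (hWsymm t ht).eq]
  obtain ⟨v, hv⟩ : ∃ v, v = V *ᵥ δx t := ⟨_, rfl⟩
  have hx : δx t = W t *ᵥ v := by
    rw [hv, Matrix.mulVec_mulVec, hV, Matrix.mul_nonsing_inv _ hdet, Matrix.one_mulVec]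
  have hxV (y : Fin n → ℝ) : δx t ⬝ᵥ (V *ᵥ y) = v ⬝ᵥ y := by
    rw [hv, Matrix.dotProduct_mulVec, ← Matrix.mulVec_transpose, hVsymm]
  have htr {k l : ℕ} (N : Matrix (Fin k) (Fin l) ℝ) (y : Fin l → ℝ) (z : Fin k → ℝ) :
      y ⬝ᵥ (Nᵀ *ᵥ z) = z ⬝ᵥ (N *ᵥ y) := by
    rw [Matrix.mulVec_transpose, dotProduct_comm, Matrix.dotProduct_mulVec]
  have hclosed : (A t + B t * (Y t * V)) *ᵥ δx t = (A t * W t + B t * Y t) *ᵥ v := by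
    simp only [Matrix.add_mulVec, ← Matrix.mulVec_mulVec, ← hv, ← hx]
  have hinv : δx t ⬝ᵥ (-(V * W' t * V) *ᵥ δx t) = -(v ⬝ᵥ (W' t *ᵥ v)) := by
    simp only [Matrix.neg_mulVec, dotProduct_neg, ← Matrix.mulVec_mulVec, ← hv, hxV]
  have hAT : W t * (A t)ᵀ = (A t * W t)ᵀ := by
    rw [Matrix.transpose_mul, (hWsymm t ht).eq]
  have hLMI' := (hLMI t ht).dotProduct_mulVec_nonneg v
  rw [hAT, ← Matrix.transpose_mul] at hLMI'
  simp only [star_trivial, Matrix.sub_mulVec, Matrix.add_mulVec, Matrix.neg_mulVec,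
    Matrix.smul_mulVec, dotProduct_sub, dotProduct_add, dotProduct_neg, dotProduct_smul,
    htr, smul_eq_mul, ← hx] at hLMI'
  rw [hclosed, hinv, hxV, hxV, ← hv, dotProduct_comm _ v]
  simp only [Matrix.add_mulVec, dotProduct_add]
  linarith
end
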